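/- There exists a constant C > 0 (depending only on q and χ) such that for every real t ≥ 4, the sum over the nontrivial zeros ρ of L(·,χ) (i.e. over the set of ρ ∈ ℂ with L(ρ,χ) = 0 and 0 ≤ Re(ρ) ≤ 1) of 1/(1 + (Im(ρ) − t)²) is at most C·log t. -/

import Mathlib

open Complex DirichletCharacter Finset

/-- The summatory function of a nontrivial Dirichlet character is bounded. -/
lemma norm_sum_character_le {q : ℕ} [NeZero q] {χ : DirichletCharacter ℂ q} (hχ : χ ≠ 1) (n : ℕ) :
    ‖∑ k ∈ Icc 1 n, χ (k : ZMod q)‖ ≤ q + 1 := by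
  have hper : ∀ n : ℕ, ∑ k ∈ range (n + q), χ (k : ZMod q) = ∑ k ∈ range n, χ (k : ZMod q) := by
    intro n
    induction n with
    | zero =>
      have h0 := χ.sum_eq_zero_of_ne_one hχ
      simp only [zero_add, sum_range_zero]
      rw [← h0]
      refine Finset.sum_bij' (fun k _ => (k : ZMod q)) (fun a _ => a.val) ?_ ?_ ?_ ?_ ?_
      · simp
      · intro a _; simpa using ZMod.val_lt a
      · intro a ha; simpa using ZMod.val_cast_of_lt (by simpa using ha)
      · intro a _; simp
      · simp
    | succ n ih =>
      rw [show n + 1 + q = n + q + 1 by ring, sum_range_succ, ih, sum_range_succ]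
      simp
  have hbound : ∀ n : ℕ, ‖∑ k ∈ range n, χ (k : ZMod q)‖ ≤ q := by
    intro n
    induction n using Nat.strong_induction_on with
    | _ n ih =>
      rcases lt_or_ge n q with h | h
      · calc _ ≤ ∑ k ∈ range n, ‖χ (k : ZMod q)‖ := norm_sum_le _ _
          _ ≤ ∑ k ∈ range n, (1 : ℝ) := sum_le_sum fun k _ => χ.norm_le_one _
          _ ≤ q := by simpa using h.le
      · obtain ⟨m, rfl⟩ := Nat.exists_eq_add_of_le' h
        rw [hper]
        exact ih m (by have := NeZero.pos q; omega)
  have hI : ∑ k ∈ Icc 1 n, χ (k : ZMod q)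
      = ∑ k ∈ range (n + 1), χ (k : ZMod q) - χ (0 : ZMod q) := by
    rw [Finset.range_eq_Ico, Finset.sum_eq_sum_Ico_succ_bot (by omega)]
    simp
    rfl
  rw [hI]
  exact (norm_sub_le _ _).trans <| add_le_add (hbound _) (χ.norm_le_one _)

/-- The `L`-function of a nontrivial character mod `q` is `O(|s|)` in the half-plane `Re s ≥ 1/10`. -/
lemma norm_LFunction_le {q : ℕ} [NeZero q] {χ : DirichletCharacter ℂ q} (hχ : χ ≠ 1) {s : ℂ}
    (hs : 1 / 10 ≤ s.re) : ‖LFunction χ s‖ ≤ 10 * (q + 1) * ‖s‖ := by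
  set S : ℝ → ℂ := fun t => ∑ k ∈ Icc 1 ⌊t⌋₊, χ (k : ZMod q) with hS
  have hSle : ∀ t, ‖S t‖ ≤ q + 1 := fun t => norm_sum_character_le hχ _
  have hS0 : ∀ t < 1, S t = 0 := fun t ht => by
    simp [hS, Nat.floor_eq_zero.2 ht]
  have hmeas : Measurable S :=
    (measurable_from_nat (f := fun n : ℕ => ∑ k ∈ Icc 1 n, χ (k : ZMod q))).comp Nat.measurable_floor
  have hloc : MeasureTheory.LocallyIntegrableOn S (Set.Ioi 0) :=
    ((MeasureTheory.locallyIntegrable_const ((q : ℝ) + 1)).mono hmeas.aestronglyMeasurable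
      (Filter.Eventually.of_forall fun t => (hSle t).trans (le_abs_self _))).locallyIntegrableOn _
  have hdiff : ∀ z : ℂ, 0 < z.re → DifferentiableAt ℂ (fun z => z * mellin S (-z)) z := by
    intro z hz
    have h := mellin_differentiableAt_of_isBigO_rpow (a := 0) (b := (-z).re - 1) (s := -z) hloc
      (by
        refine Asymptotics.IsBigO.of_bound (q + 1) (Filter.Eventually.of_forall fun t => ?_)
        simpa using hSle t) (by simpa using hz)
      (by
        refine Asymptotics.IsBigO.of_bound 0 ?_
        filter_upwards [mem_nhdsWithin_of_mem_nhds (Iio_mem_nhds (zero_lt_one' ℝ))] with t ht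
        simp [hS0 t ht]) (by simp)
    exact differentiableAt_id.mul
      (DifferentiableAt.comp (g := mellin S) z h differentiable_neg.differentiableAt)
  have hmel : ∀ z : ℂ, mellin S (-z) = ∫ t in Set.Ioi (1 : ℝ), S t * (t : ℂ) ^ (-(z + 1)) := by
    intro z
    rw [mellin, ← MeasureTheory.integral_Ici_eq_integral_Ioi (x := (1:ℝ))]
    rw [MeasureTheory.setIntegral_eq_of_subset_of_forall_sdiff_eq_zero measurableSet_Ioi
      (s := Set.Ici (1:ℝ))]
    · refine MeasureTheory.setIntegral_congr_fun measurableSet_Ici fun t _ => ?_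
      simp only [smul_eq_mul]
      rw [mul_comm, neg_add']
    · exact Set.Ici_subset_Ioi.2 one_pos
    · rintro t ⟨_, ht⟩
      simp [hS0 t (by simpa using ht)]
  have hopen : IsOpen {z : ℂ | 0 < z.re} := isOpen_lt continuous_const continuous_re
  have heq : Set.EqOn (LFunction χ) (fun z => z * mellin S (-z)) {z : ℂ | 0 < z.re} := by
    refine AnalyticOnNhd.eqOn_of_preconnected_of_eventuallyEq (z₀ := 2)
      ((differentiable_LFunction hχ).differentiableOn.analyticOnNhd hopen)
      (DifferentiableOn.analyticOnNhd (fun z hz => (hdiff z hz).differentiableWithinAt) hopen)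
      (convex_halfSpace_re_gt 0).isPreconnected (by simp) ?_
    filter_upwards [(isOpen_lt continuous_const continuous_re).mem_nhds
      (show (2 : ℂ) ∈ {z : ℂ | 1 < z.re} by simp)] with z hz
    have hz : 1 < z.re := hz
    rw [LFunction_eq_LSeries χ hz, hmel]
    refine LSeries_eq_mul_integral (r := 0) _ le_rfl (by linarith)
      (χ.LSeriesSummable_of_one_lt_re hz) ?_
    refine Asymptotics.IsBigO.of_bound (q + 1) (Filter.Eventually.of_forall fun n => ?_)
    simpa using norm_sum_character_le hχ n
  rw [heq (show 0 < s.re by linarith), norm_mul, mul_comm, hmel]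
  gcongr
  have hlt : (-11 / 10 : ℝ) < -1 := by norm_num
  calc _ ≤ ∫ t in Set.Ioi (1 : ℝ), (q + 1) * t ^ (-11 / 10 : ℝ) := by
        refine MeasureTheory.norm_integral_le_of_norm_le
          ((integrableOn_Ioi_rpow_of_lt hlt one_pos).const_mul _) ?_
        refine (MeasureTheory.ae_restrict_mem measurableSet_Ioi).mono fun t ht => ?_
        have ht : 1 < t := ht
        rw [norm_mul, norm_cpow_eq_rpow_re_of_pos (by linarith)]
        gcongr
        · exact hSle t
        · exact ht.le
        · simp; linarith
    _ = 10 * (q + 1) := by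
        rw [MeasureTheory.integral_const_mul, integral_Ioi_rpow_of_lt hlt one_pos]
        norm_num
        ring

/-- On the line `Re s = 2`, Dirichlet `L`-functions are bounded away from zero. -/
lemma le_norm_LFunction_two_add {q : ℕ} [NeZero q] (χ : DirichletCharacter ℂ q) {s : ℂ}
    (hs : s.re = 2) : 1 / 4 ≤ ‖LFunction χ s‖ := by
  have hs1 : 1 < s.re := by rw [hs]; norm_num
  rw [LFunction_eq_LSeries χ hs1]
  have hsum := χ.LSeriesSummable_of_one_lt_re hs1
  have hz := hasSum_zeta_two
  have hle : ∀ n : ℕ, ‖LSeries.term (fun n => χ (n : ZMod q)) s n‖ ≤ 1 / (n : ℝ) ^ 2 := by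
    intro n
    rcases eq_or_ne n 0 with rfl | hn
    · simp
    · rw [LSeries.norm_term_eq, if_neg hn, hs, Real.rpow_ofNat]
      gcongr
      exact χ.norm_le_one _
  have h2 : LSeries (fun n => χ (n : ZMod q)) s
      = 1 + ∑' n : ℕ, LSeries.term (fun n => χ (n : ZMod q)) s (n + 2) := by
    rw [LSeries, ← hsum.sum_add_tsum_nat_add 2]
    simp [sum_range_succ, LSeries.term]
  have h3 : ‖∑' n : ℕ, LSeries.term (fun n => χ (n : ZMod q)) s (n + 2)‖ ≤ Real.pi ^ 2 / 6 - 1 := by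
    have h := (hasSum_nat_add_iff' 2).2 hz
    refine tsum_of_norm_bounded (by simpa [sum_range_succ] using h) fun n => ?_
    simpa using hle (n + 2)
  have hpi : Real.pi ^ 2 ≤ 10.5 := by nlinarith [Real.pi_lt_d2, Real.pi_pos]
  rw [h2]
  have h4 := norm_sub_le_norm_add (1 : ℂ) (∑' n : ℕ, LSeries.term (fun n => χ (n : ZMod q)) s (n + 2))
  rw [norm_one] at h4
  norm_num at hpi
  linarith

/-- Jensen's bound for the cardinality of a finite set of zeros in a disc. -/
lemma card_zeros_le_of_norm_le {f : ℂ → ℂ} (hf : Differentiable ℂ f) {c : ℂ} {r R M : ℝ}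
    (hr : 0 < r) (hrR : r < R) (hM : 1 ≤ M) (hc : f c ≠ 0)
    (hbound : ∀ z ∈ Metric.sphere c R, ‖f z‖ ≤ M) {F : Finset ℂ}
    (hF : ∀ z ∈ F, f z = 0 ∧ z ∈ Metric.closedBall c r) :
    (#F : ℝ) ≤ Real.log (M / ‖f c‖) / Real.log (R / r) := by
  have han : ∀ s, AnalyticOnNhd ℂ f s := fun s z _ => hf.analyticAt z
  have hR : 0 < R := hr.trans hrR
  refine le_trans ?_ (AnalyticOnNhd.sum_divisor_le (r := r) (R := R) (by rwa [abs_of_pos hr])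
    (by rwa [abs_of_pos hr, abs_of_pos hR]) hM (han _) hc (by rwa [abs_of_pos hR]))
  rw [abs_of_pos hr]
  set D := MeromorphicOn.divisor f (Metric.closedBall c r) with hD
  have hfin : Function.HasFiniteSupport D := D.finiteSupport (isCompact_closedBall _ _)
  have hnn : ∀ z, 0 ≤ D z := MeromorphicOn.AnalyticOnNhd.divisor_nonneg (han _)
  have hone : ∀ z ∈ F, 1 ≤ D z := by
    intro z hz
    obtain ⟨h0, hzb⟩ := hF z hz
    have htop : analyticOrderAt f z ≠ ⊤ := by
      intro h
      rw [analyticOrderAt_eq_top] at h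
      exact hc ((han Set.univ).eqOn_of_preconnected_of_eventuallyEq (g := fun _ => 0)
        analyticOnNhd_const isPreconnected_univ (Set.mem_univ z) h (Set.mem_univ c))
    have hne : analyticOrderAt f z ≠ 0 := (hf.analyticAt z).analyticOrderAt_ne_zero.2 h0
    rw [hD, MeromorphicOn.AnalyticOnNhd.divisor_apply (han _) hzb]
    lift analyticOrderAt f z to ℕ using htop with n
    have hn : n ≠ 0 := by exact_mod_cast hne
    simp
    omega
  have : (#F : ℤ) ≤ ∑ᶠ z, D z := by
    rw [finsum_eq_sum_of_support_subset (s := hfin.toFinset ∪ F) _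
      (fun z hz => mem_coe.2 (mem_union_left _ (hfin.mem_toFinset.2 hz)))]
    calc (#F : ℤ) = ∑ z ∈ F, 1 := by simp
      _ ≤ ∑ z ∈ F, D z := sum_le_sum hone
      _ ≤ _ := sum_le_sum_of_subset_of_nonneg subset_union_right fun z _ _ => hnn z
  exact_mod_cast this

/-- The number of zeros with `Re ρ ≥ 1/2` in a unit window at height `T` is `O(log (|T| + 4))`. -/
lemma exists_card_zeros_right_le {q : ℕ} [NeZero q] {χ : DirichletCharacter ℂ q} (hχ : χ ≠ 1) :
    ∃ C : ℝ, 0 < C ∧ ∀ (T : ℝ) (F : Finset ℂ),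
      (∀ ρ ∈ F, LFunction χ ρ = 0 ∧ 1 / 2 ≤ ρ.re ∧ ρ.re ≤ 1 ∧ |ρ.im - T| ≤ 1 / 2) →
        (#F : ℝ) ≤ C * Real.log (|T| + 4) := by
  have hlog : 0 < Real.log (1.9 / 1.6) := Real.log_pos (by norm_num)
  have hA : 0 < Real.log (40 * (q + 1)) :=
    Real.log_pos (by have : (0 : ℝ) ≤ q := q.cast_nonneg; linarith)
  refine ⟨(Real.log (40 * (q + 1)) + 1) / Real.log (1.9 / 1.6), by positivity, fun T F hF => ?_⟩
  have hT := abs_nonneg T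
  have hlogT : 1 ≤ Real.log (|T| + 4) := by
    rw [Real.le_log_iff_exp_le (by linarith)]
    linarith [Real.exp_one_lt_d9]
  set c : ℂ := ⟨2, T⟩ with hc
  have hcn := le_norm_LFunction_two_add χ (s := c) rfl
  have hq : (0 : ℝ) ≤ q := q.cast_nonneg
  have hM : 1 ≤ 10 * ((q : ℝ) + 1) * (|T| + 4) := by nlinarith
  have hcard := card_zeros_le_of_norm_le (r := 1.6) (R := 1.9) (F := F) (c := c)
    (differentiable_LFunction hχ) (by norm_num) (by norm_num) hM
    (norm_pos_iff.1 (by linarith)) (fun z hz => ?_) (fun z hz => ?_)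
  · refine hcard.trans ?_
    rw [div_mul_eq_mul_div]
    gcongr
    calc Real.log (10 * (q + 1) * (|T| + 4) / ‖LFunction χ c‖)
        ≤ Real.log (10 * (q + 1) * (|T| + 4) / (1 / 4)) := by
          gcongr
      _ = Real.log (40 * (q + 1)) + Real.log (|T| + 4) := by
          rw [← Real.log_mul (by positivity) (by positivity)]
          congr 1
          ring
      _ ≤ _ := by nlinarith
  · rw [mem_sphere_iff_norm] at hz
    have h1 := (abs_le.1 ((abs_re_le_norm (z - c)).trans hz.le)).1
    have h2 : ‖c‖ ≤ 2 + |T| := by simpa [hc] using norm_le_abs_re_add_abs_im c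
    have h3 := norm_le_norm_add_norm_sub' z c
    simp only [hc, sub_re] at h1
    refine (norm_LFunction_le hχ (by norm_num at h1 ⊢; linarith)).trans ?_
    gcongr
    norm_num at hz
    linarith
  · obtain ⟨h0, h1, h2, h3⟩ := hF z hz
    refine ⟨h0, ?_⟩
    rw [mem_closedBall_iff_norm, ← abs_of_pos (show (0 : ℝ) < 1.6 by norm_num), ← abs_norm,
      ← sq_le_sq, Complex.sq_norm, Complex.normSq_apply]
    simp only [hc, sub_re, sub_im]
    have := abs_le.1 h3
    norm_num
    nlinarith

/-- A zero of `L(·,χ)` other than `0` in `Re s ≥ 0` reflects to a zero of `L(·,χ⁻¹)`. -/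
lemma LFunction_inv_one_sub_eq_zero {q : ℕ} [NeZero q] (hq : q ≠ 1) {χ : DirichletCharacter ℂ q}
    (hχ : χ.IsPrimitive) {s : ℂ} (hs : 0 ≤ s.re) (hs0 : s ≠ 0) (h : LFunction χ s = 0) :
    LFunction χ⁻¹ (1 - s) = 0 := by
  have hχ' : χ⁻¹.IsPrimitive := by rw [isPrimitive_def, conductor_inv]; exact hχ
  have hgamma : gammaFactor χ s ≠ 0 := by
    rcases χ.even_or_odd with hp | hp
    · rw [hp.gammaFactor_def, Ne, Gammaℝ_eq_zero_iff]
      rintro ⟨n, rfl⟩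
      simp only [neg_re, mul_re, re_ofNat, natCast_re, im_ofNat, natCast_im, mul_zero, sub_zero] at hs
      have hn : (n : ℝ) ≤ 0 := by linarith
      have : n = 0 := by exact_mod_cast le_antisymm hn n.cast_nonneg
      simp [this] at hs0
    · rw [hp.gammaFactor_def]
      exact Gammaℝ_ne_zero_of_re_pos (by simp; linarith)
  have hcompl : completedLFunction χ s = 0 := by
    rw [LFunction_eq_completed_div_gammaFactor χ s (Or.inr hq)] at h
    simpa [hgamma] using h
  rw [LFunction_eq_completed_div_gammaFactor _ _ (Or.inr hq), hχ'.completedLFunction_one_sub,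
    inv_inv, hcompl]
  simp

/-- The number of nontrivial zeros in a unit window at height `T` is `O(log (|T| + 4))`. -/
lemma exists_card_zeros_le {q : ℕ} [NeZero q] (hq : q ≠ 1) {χ : DirichletCharacter ℂ q}
    (hχ : χ.IsPrimitive) :
    ∃ C : ℝ, 0 < C ∧ ∀ (T : ℝ) (F : Finset ℂ),
      (∀ ρ ∈ F, LFunction χ ρ = 0 ∧ 0 ≤ ρ.re ∧ ρ.re ≤ 1 ∧ |ρ.im - T| ≤ 1 / 2) →
        (#F : ℝ) ≤ C * Real.log (|T| + 4) := by
  have h1 : χ ≠ 1 := by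
    rintro rfl
    rw [isPrimitive_def, conductor_one] at hχ
    exact hq hχ.symm
  obtain ⟨C₁, hC₁, hb₁⟩ := exists_card_zeros_right_le h1
  obtain ⟨C₂, hC₂, hb₂⟩ := exists_card_zeros_right_le (inv_ne_one.2 h1)
  refine ⟨C₁ + C₂ + 1, by positivity, fun T F hF => ?_⟩
  have hlogT : 1 ≤ Real.log (|T| + 4) := by
    have hT := abs_nonneg T
    rw [Real.le_log_iff_exp_le (by linarith)]
    linarith [Real.exp_one_lt_d9]
  have hright := hb₁ T (F.filter fun ρ => 1 / 2 ≤ ρ.re) (by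
    intro ρ hρ
    rw [mem_filter] at hρ
    obtain ⟨h0, _, h2, h3⟩ := hF ρ hρ.1
    exact ⟨h0, hρ.2, h2, h3⟩)
  have hleft := hb₂ (-T) (((F.filter fun ρ => ¬ 1 / 2 ≤ ρ.re).erase 0).image fun ρ => 1 - ρ) (by
    intro ρ hρ
    obtain ⟨w, hw, rfl⟩ := mem_image.1 hρ
    rw [mem_erase, mem_filter, not_le] at hw
    obtain ⟨h0, h1, h2, h3⟩ := hF w hw.2.1
    refine ⟨LFunction_inv_one_sub_eq_zero hq hχ h1 hw.1 h0, ?_, ?_, ?_⟩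
    · simp only [sub_re, one_re]; linarith [hw.2.2]
    · simp only [sub_re, one_re]; linarith
    · rwa [show (1 - w).im - -T = -(w.im - T) by simp; ring, abs_neg])
  rw [card_image_of_injective _ sub_right_injective, abs_neg] at hleft
  have hsplit : #F ≤ #(F.filter fun ρ => 1 / 2 ≤ ρ.re)
      + (#((F.filter fun ρ => ¬ 1 / 2 ≤ ρ.re).erase 0) + 1) := by
    rw [← card_filter_add_card_filter_not (s := F) (fun ρ : ℂ => 1 / 2 ≤ ρ.re)]
    gcongr
    have := pred_card_le_card_erase (s := F.filter fun ρ : ℂ => ¬ 1 / 2 ≤ ρ.re) (a := 0)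
    omega
  have hsplit' : (#F : ℝ) ≤ #(F.filter fun ρ => 1 / 2 ≤ ρ.re)
      + (#((F.filter fun ρ => ¬ 1 / 2 ≤ ρ.re).erase 0) + 1) := by exact_mod_cast hsplit
  linarith

/-- The weights `log (2 + |m|) / (1 + m²)` are summable over the integers. -/
lemma summable_log_div_one_add_sq :
    Summable fun m : ℤ => Real.log (2 + |(m : ℝ)|) / (1 + (m : ℝ) ^ 2) := by
  refine Summable.of_norm_bounded_eventually
    ((Real.summable_abs_int_rpow (b := 3 / 2) (by norm_num)).mul_left 4) ?_
  filter_upwards [(Set.finite_singleton (0 : ℤ)).compl_mem_cofinite] with m hm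
  have hm1 : 1 ≤ |(m : ℝ)| := by exact_mod_cast Int.one_le_abs hm
  set x := |(m : ℝ)| with hx
  rw [← sq_abs, ← hx]
  have hlog0 : 0 ≤ Real.log (2 + x) := Real.log_nonneg (by linarith)
  rw [Real.norm_of_nonneg (by positivity)]
  have hlog : Real.log (2 + x) ≤ 4 * x ^ (1 / 2 : ℝ) := by
    have h1 := Real.log_le_rpow_div (show 0 ≤ 2 + x by linarith) (show (0 : ℝ) < 1 / 2 by norm_num)
    have h2 : (2 + x) ^ (1 / 2 : ℝ) ≤ (4 * x) ^ (1 / 2 : ℝ) := by gcongr; linarith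
    rw [Real.mul_rpow (by norm_num) (by linarith), ← Real.sqrt_eq_rpow 4,
      show (4 : ℝ) = 2 ^ 2 by norm_num, Real.sqrt_sq (by norm_num)] at h2
    linarith
  calc Real.log (2 + x) / (1 + x ^ 2) ≤ 4 * x ^ (1 / 2 : ℝ) / x ^ 2 := by
        gcongr
        linarith
    _ = 4 * x ^ (-(3 / 2) : ℝ) := by
        rw [mul_div_assoc, ← Real.rpow_natCast x 2, ← Real.rpow_sub (by linarith)]
        norm_num

/-- The number of nontrivial zeros of `L(·,χ)` near height `t` is `O(log t)`: the sum over
nontrivial zeros `ρ` of `1/(1 + (Im ρ − t)²)` is at most `C log t` for `t ≥ 4`. -/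
theorem zero_density_sum (q : ℕ) [NeZero q] (hq : 2 < q)
    (χ : DirichletCharacter ℂ q) (hχ : χ.IsPrimitive) :
    ∃ C : ℝ, 0 < C ∧
      ∀ t : ℝ, 4 ≤ t →
        Summable (fun ρ : {ρ : ℂ // LFunction χ ρ = 0 ∧ 0 ≤ ρ.re ∧ ρ.re ≤ 1} =>
          1 / (1 + ((ρ : ℂ).im - t) ^ 2)) ∧
        ∑' ρ : {ρ : ℂ // LFunction χ ρ = 0 ∧ 0 ≤ ρ.re ∧ ρ.re ≤ 1},
            1 / (1 + ((ρ : ℂ).im - t) ^ 2) ≤ C * Real.log t := by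
  obtain ⟨C, hC, hcard⟩ := exists_card_zeros_le (by omega) hχ
  set g : ℤ → ℝ := fun m => Real.log (2 + |(m : ℝ)|) / (1 + (m : ℝ) ^ 2) with hg
  have hglog : ∀ m : ℤ, 0 < Real.log (2 + |(m : ℝ)|) := fun m =>
    Real.log_pos (by linarith [abs_nonneg (m : ℝ)])
  have hg0 : ∀ m, 0 < g m := fun m => div_pos (hglog m) (by positivity)
  have hgsum : Summable g := summable_log_div_one_add_sq
  have hgpos : 0 < ∑' m, g m := hgsum.tsum_pos (fun m => (hg0 m).le) 0 (hg0 0)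
  refine ⟨2 * C * (1 + 1 / Real.log 2) * ∑' m, g m, by positivity, fun t ht => ?_⟩
  set f : {ρ : ℂ // LFunction χ ρ = 0 ∧ 0 ≤ ρ.re ∧ ρ.re ≤ 1} → ℝ := fun ρ =>
    1 / (1 + ((ρ : ℂ).im - t) ^ 2) with hf
  have hf0 : ∀ ρ, 0 ≤ f ρ := fun ρ => by positivity
  have hlogt : 1 ≤ Real.log t := by
    rw [Real.le_log_iff_exp_le (by linarith)]
    linarith [Real.exp_one_lt_d9]
  have hwindow : ∀ m : ℤ, Real.log (|t + m| + 4)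
      ≤ (1 + 1 / Real.log 2) * Real.log t * Real.log (2 + |(m : ℝ)|) := by
    intro m
    have hm := abs_nonneg (m : ℝ)
    have hl2 : 0 < Real.log 2 := Real.log_pos (by norm_num)
    have hle : Real.log 2 ≤ Real.log (2 + |(m : ℝ)|) := by gcongr; linarith
    have hone : 1 ≤ 1 / Real.log 2 * Real.log (2 + |(m : ℝ)|) := by
      rw [one_div_mul_eq_div, one_le_div hl2]
      exact hle
    calc Real.log (|t + m| + 4) ≤ Real.log (t * (2 + |(m : ℝ)|)) := by
          gcongr
          have := abs_add_le t m
          rw [abs_of_pos (show 0 < t by linarith)] at this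
          nlinarith
      _ = Real.log t + Real.log (2 + |(m : ℝ)|) := Real.log_mul (by linarith) (by linarith)
      _ ≤ _ := by nlinarith [hglog m]
  have hpartial : ∀ u : Finset {ρ : ℂ // LFunction χ ρ = 0 ∧ 0 ≤ ρ.re ∧ ρ.re ≤ 1},
      ∑ ρ ∈ u, f ρ ≤ 2 * C * (1 + 1 / Real.log 2) * (∑' m, g m) * Real.log t := by
    intro u
    set k : {ρ : ℂ // LFunction χ ρ = 0 ∧ 0 ≤ ρ.re ∧ ρ.re ≤ 1} → ℤ := fun ρ =>
      round ((ρ : ℂ).im - t) with hk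
    have hfiber : ∀ m : ℤ, ∑ ρ ∈ u with k ρ = m, f ρ
        ≤ 2 * C * (1 + 1 / Real.log 2) * Real.log t * g m := by
      intro m
      have hnear : ∀ ρ ∈ u.filter (fun ρ => k ρ = m), |(ρ : ℂ).im - t - m| ≤ 1 / 2 := by
        intro ρ hρ
        rw [← (mem_filter.1 hρ).2]
        exact abs_sub_round _
      have hterm : ∀ ρ ∈ u.filter (fun ρ => k ρ = m), f ρ ≤ 2 / (1 + (m : ℝ) ^ 2) := by
        intro ρ hρ
        have h := abs_le.1 (hnear ρ hρ)
        rw [hf, div_le_div_iff₀ (by positivity) (by positivity)]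
        nlinarith [sq_nonneg (2 * ((ρ : ℂ).im - t) - m)]
      have hn := hcard (t + m) ((u.filter fun ρ => k ρ = m).map (Function.Embedding.subtype _)) (by
        intro ρ hρ
        obtain ⟨w, hw, rfl⟩ := mem_map.1 hρ
        refine ⟨w.2.1, w.2.2.1, w.2.2.2, ?_⟩
        rw [← sub_sub]
        exact hnear w hw)
      rw [card_map] at hn
      calc _ ≤ #(u.filter fun ρ => k ρ = m) • (2 / (1 + (m : ℝ) ^ 2)) :=
            sum_le_card_nsmul _ _ _ hterm
        _ ≤ (C * ((1 + 1 / Real.log 2) * Real.log t * Real.log (2 + |(m : ℝ)|)))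
            * (2 / (1 + (m : ℝ) ^ 2)) := by
            rw [nsmul_eq_mul]
            gcongr
            exact hn.trans (by gcongr; exact hwindow m)
        _ = _ := by rw [hg]; ring
    calc ∑ ρ ∈ u, f ρ = ∑ m ∈ u.image k, ∑ ρ ∈ u with k ρ = m, f ρ :=
          (sum_fiberwise_of_maps_to (fun ρ hρ => mem_image_of_mem k hρ) f).symm
      _ ≤ ∑ m ∈ u.image k, 2 * C * (1 + 1 / Real.log 2) * Real.log t * g m :=
          sum_le_sum fun m _ => hfiber m
      _ = 2 * C * (1 + 1 / Real.log 2) * Real.log t * ∑ m ∈ u.image k, g m := by rw [mul_sum]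
      _ ≤ 2 * C * (1 + 1 / Real.log 2) * Real.log t * ∑' m, g m := by
          gcongr
          exact hgsum.sum_le_tsum _ fun m _ => (hg0 m).le
      _ = _ := by ring
  have hsum : Summable f := summable_of_sum_le hf0 hpartial
  exact ⟨hsum, hsum.tsum_le_of_sum_le hpartial⟩
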